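/- arXiv:1909.05612 — 3 statements merged into one kernel-verified Lean document; each statement's English description precedes it below -/
import Mathlib

section
/- Central limit theorem for the Curie–Weiss model: fix 0 ≤ β < 1. For each N ≥ 1 let (X_1^{(N)},…,X_N^{(N)}) be CW(β,N)-distributed and S_N = ∑_{i=1}^N X_i^{(N)}. Then the laws of S_N/√N converge weakly, as N → ∞, to the normal distribution N(0, 1/(1−β)) with mean 0 and variance 1/(1−β). -/
open MeasureTheory Filter Real Topology ENNReal

/-- The spin value associated to a Boolean: `true ↦ +1`, `false ↦ -1`. -/
noncomputable def spin (b : Bool) : ℝ := if b then 1 else -1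

/-- The (unnormalized) Curie–Weiss Boltzmann weight of a configuration. -/
noncomputable def cwWeight (β : ℝ) (N : ℕ) (σ : Fin N → Bool) : ℝ :=
  Real.exp (β / (2 * N) * (∑ i, spin (σ i)) ^ 2)

/-- The Curie–Weiss partition function. -/
noncomputable def cwZ (β : ℝ) (N : ℕ) : ℝ :=
  ∑ σ : Fin N → Bool, cwWeight β N σ

/-- Expectation with respect to the Curie–Weiss distribution `CW(β,N)`. -/
noncomputable def cwExp (β : ℝ) (N : ℕ) (f : (Fin N → Bool) → ℝ) : ℝ :=
  (∑ σ : Fin N → Bool, cwWeight β N σ * f σ) / cwZ β N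

/-- Law on `ℝ` of the observable `g` under the Curie–Weiss distribution `CW(β,N)`. -/
noncomputable def cwLaw (β : ℝ) (N : ℕ) (g : (Fin N → Bool) → ℝ) : Measure ℝ :=
  ∑ σ : Fin N → Bool, ENNReal.ofReal (cwWeight β N σ / cwZ β N) • Measure.dirac (g σ)

/-- The correlation `E_{β,N}(X_1 ⋯ X_ℓ)` of the first `ℓ` spins. -/
noncomputable def cwCorr (β : ℝ) (N ℓ : ℕ) : ℝ :=
  cwExp β N (fun σ => ∏ j ∈ Finset.univ.filter (fun j : Fin N => (j : ℕ) < ℓ), spin (σ j))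

open ProbabilityTheory

lemma cwZ_pos (β : ℝ) (N : ℕ) : 0 < cwZ β N :=
  Finset.sum_pos (fun _ _ ↦ Real.exp_pos _) Finset.univ_nonempty

instance isProbabilityMeasure_cwLaw (β : ℝ) (N : ℕ) (g : (Fin N → Bool) → ℝ) :
    IsProbabilityMeasure (cwLaw β N g) where
  measure_univ := by
    have h : ∀ σ ∈ Finset.univ, 0 ≤ cwWeight β N σ / cwZ β N := fun σ _ ↦
      div_nonneg (Real.exp_pos _).le (cwZ_pos β N).le
    simp only [cwLaw, Measure.coe_finsetSum, Finset.sum_apply, Measure.smul_apply, measure_univ,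
      smul_eq_mul, mul_one]
    rw [← ENNReal.ofReal_sum_of_nonneg h, ← Finset.sum_div]
    rw [← cwZ, div_self (cwZ_pos β N).ne', ENNReal.ofReal_one]

lemma integral_cwLaw {E : Type*} [NormedAddCommGroup E] [NormedSpace ℝ E] [CompleteSpace E]
    (β : ℝ) (N : ℕ) (g : (Fin N → Bool) → ℝ) (f : ℝ → E) :
    ∫ x, f x ∂(cwLaw β N g) = ∑ σ, (cwWeight β N σ / cwZ β N) • f (g σ) := by
  rw [cwLaw, integral_finsetSum_measure]
  · refine Finset.sum_congr rfl fun σ _ ↦ ?_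
    have h : 0 ≤ cwWeight β N σ / cwZ β N := div_nonneg (Real.exp_pos _).le (cwZ_pos β N).le
    rw [integral_smul_measure, integral_dirac, ENNReal.toReal_ofReal h]
  · exact fun σ _ ↦ (integrable_dirac (by simp)).smul_measure (by simp)

/-- The unnormalized complex moment generating function of `S_N / √N` under `CW(β,N)`. -/
noncomputable def cwMGF (β : ℝ) (N : ℕ) (s : ℂ) : ℂ :=
  ∑ σ : Fin N → Bool, (cwWeight β N σ : ℂ) * Complex.exp (s * ((∑ i, spin (σ i)) / √N : ℝ))

lemma cwMGF_zero (β : ℝ) (N : ℕ) : cwMGF β N 0 = cwZ β N := by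
  simp [cwMGF, cwZ]

lemma charFun_cwLaw (β : ℝ) (N : ℕ) (t : ℝ) :
    charFun (cwLaw β N (fun σ => (∑ i, spin (σ i)) / √N)) t =
      cwMGF β N (t * Complex.I) / cwMGF β N 0 := by
  rw [charFun_apply_real, integral_cwLaw, cwMGF_zero, cwMGF, Finset.sum_div]
  refine Finset.sum_congr rfl fun σ _ ↦ ?_
  rw [Complex.real_smul, mul_right_comm (t : ℂ)]
  push_cast
  ring

lemma sum_cexp_mul_sum_spin (N : ℕ) (c : ℂ) :
    ∑ σ : Fin N → Bool, Complex.exp (c * (∑ i, spin (σ i) : ℝ)) = (2 * Complex.cosh c) ^ N := by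
  have h := Finset.prod_univ_sum (fun _ : Fin N ↦ (Finset.univ : Finset Bool))
    (fun _ b ↦ Complex.exp (c * spin b))
  simp only [Fintype.piFinset_univ, ← Complex.exp_sum, ← Finset.mul_sum] at h
  push_cast
  rw [← h]
  simp [spin, Complex.two_cosh]

/-- The **Hubbard–Stratonovich transformation** of the Curie–Weiss model. -/
lemma cwMGF_eq_integral {β : ℝ} (hβ : 0 ≤ β) (N : ℕ) (s : ℂ) :
    cwMGF β N s =
      ∫ x : ℝ, (2 * Complex.cosh ((√β * x + s) / √N)) ^ N ∂(gaussianReal 0 1) := by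
  simp_rw [← sum_cexp_mul_sum_spin]
  have key : ∀ σ : Fin N → Bool, ∀ x : ℝ,
      Complex.exp ((√β * x + s) / √N * (∑ i, spin (σ i) : ℝ)) =
        Complex.exp (s * ((∑ i, spin (σ i)) / √N : ℝ)) *
          Complex.exp ((√β / √N * ∑ i, spin (σ i) : ℝ) * x) := by
    intro σ x
    rw [← Complex.exp_add]
    push_cast
    ring_nf
  simp_rw [key]
  rw [integral_finsetSum]
  · refine Finset.sum_congr rfl fun σ _ ↦ ?_
    have h := complexMGF_id_gaussianReal (μ := 0) (v := 1)
      ((√β / √N * ∑ i, spin (σ i) : ℝ) : ℂ)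
    simp only [complexMGF, id_eq] at h
    rw [integral_const_mul, h, mul_comm, cwWeight]
    congr 1
    rw [Complex.ofReal_exp]
    congr 1
    have : β / (2 * N) * (∑ i, spin (σ i)) ^ 2 = (√β / √N * ∑ i, spin (σ i)) ^ 2 / 2 := by
      rw [mul_pow, div_pow, Real.sq_sqrt hβ, Real.sq_sqrt N.cast_nonneg]
      ring
    rw [this]
    push_cast
    simp
  · intro σ _
    refine Integrable.const_mul ?_ _
    have h := (integrable_exp_mul_gaussianReal (μ := 0) (v := 1)
      (√β / √N * ∑ i, spin (σ i))).ofReal (𝕜 := ℂ)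
    simpa using h

lemma norm_ccosh_le (z : ℂ) : ‖Complex.cosh z‖ ≤ Real.cosh z.re := by
  rw [Complex.cosh, Real.cosh_eq, norm_div, Complex.norm_two]
  gcongr
  refine (norm_add_le _ _).trans ?_
  simp [Complex.norm_exp]

lemma tendsto_sqrt_mul_csinh (c : ℂ) :
    Tendsto (fun N : ℕ ↦ (√N : ℂ) * Complex.sinh (c / √N)) atTop (𝓝 c) := by
  have hd : HasDerivAt (fun u : ℂ ↦ Complex.sinh (c * u)) c 0 := by
    simpa using ((hasDerivAt_id (0 : ℂ)).const_mul c).csinh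
  have hlim : Tendsto (fun N : ℕ ↦ ((√N)⁻¹ : ℂ)) atTop (𝓝[≠] 0) := by
    refine tendsto_nhdsWithin_iff.2 ⟨?_, ?_⟩
    · have : Tendsto (fun N : ℕ ↦ (√N)⁻¹) atTop (𝓝 0) :=
        tendsto_inv_atTop_zero.comp (Real.tendsto_sqrt_atTop.comp tendsto_natCast_atTop_atTop)
      exact_mod_cast (Complex.continuous_ofReal.tendsto 0).comp this
    · filter_upwards [eventually_gt_atTop 0] with N hN
      have : 0 < √(N : ℝ) := Real.sqrt_pos.2 (by exact_mod_cast hN)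
      simpa using this.ne'
  have := (hasDerivAt_iff_tendsto_slope_zero.1 hd).comp hlim
  simpa [Function.comp_def, div_eq_mul_inv] using this

lemma tendsto_ccosh_div_sqrt_pow (z : ℂ) :
    Tendsto (fun N : ℕ ↦ Complex.cosh (z / √N) ^ N) atTop (𝓝 (Complex.exp (z ^ 2 / 2))) := by
  have h : ∀ N : ℕ, Complex.cosh (z / √N) = 1 + 2 * Complex.sinh (z / 2 / √N) ^ 2 := by
    intro N
    rw [show z / √N = 2 * (z / 2 / √N) by ring, Complex.cosh_two_mul, Complex.cosh_sq]
    ring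
  simp_rw [h]
  refine Complex.tendsto_one_add_pow_exp_of_tendsto ?_
  have := ((tendsto_sqrt_mul_csinh (z / 2)).pow 2).const_mul 2
  convert this using 2 with N
  · rw [mul_pow, ← Complex.ofReal_pow, Real.sq_sqrt N.cast_nonneg]
    push_cast
    ring
  · ring

lemma integrable_exp_mul_sq_gaussianReal {β : ℝ} (hβ : β < 1) :
    Integrable (fun x ↦ Real.exp (β * x ^ 2 / 2)) (gaussianReal 0 1) := by
  rw [gaussianReal_of_var_ne_zero 0 one_ne_zero, integrable_withDensity_iff_integrable_smul'
    (measurable_gaussianPDF _ _) (ae_of_all _ fun _ ↦ gaussianPDF_lt_top)]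
  refine ((integrable_exp_neg_mul_sq (b := (1 - β) / 2) (by linarith)).const_mul
    (√(2 * π))⁻¹).congr (ae_of_all _ fun x ↦ ?_)
  simp only [toReal_gaussianPDF, gaussianPDFReal_def, smul_eq_mul, mul_assoc, ← Real.exp_add,
    NNReal.coe_one, mul_one]
  ring_nf

lemma tendsto_cwMGF_div_two_pow {β : ℝ} (hβ0 : 0 ≤ β) (hβ1 : β < 1) {s : ℂ} (hs : s.re = 0) :
    Tendsto (fun N : ℕ ↦ cwMGF β N s / 2 ^ N) atTop
      (𝓝 (∫ x : ℝ, Complex.exp ((√β * x + s) ^ 2 / 2) ∂(gaussianReal 0 1))) := by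
  have h : ∀ N : ℕ, cwMGF β N s / 2 ^ N =
      ∫ x : ℝ, Complex.cosh ((√β * x + s) / √N) ^ N ∂(gaussianReal 0 1) := by
    intro N
    simp_rw [cwMGF_eq_integral hβ0, mul_pow]
    rw [integral_const_mul, mul_div_cancel_left₀ _ (by simp)]
  simp_rw [h]
  refine tendsto_integral_of_dominated_convergence (fun x ↦ Real.exp (β * x ^ 2 / 2))
    (fun N ↦ ?_) (integrable_exp_mul_sq_gaussianReal hβ1) (fun N ↦ ae_of_all _ fun x ↦ ?_)
    (ae_of_all _ fun x ↦ tendsto_ccosh_div_sqrt_pow _)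
  · exact Continuous.aestronglyMeasurable
      ((Complex.continuous_cosh.comp (by fun_prop)).pow N)
  · have hre : ((√β * x + s) / √N : ℂ).re = √β * x / √N := by
      rw [Complex.div_ofReal_re]
      simp [hs]
    rw [norm_pow]
    refine (pow_le_pow_left₀ (norm_nonneg _)
      ((norm_ccosh_le _).trans (Real.cosh_le_exp_half_sq _)) N).trans ?_
    rw [hre, ← Real.exp_nat_mul, div_pow, mul_pow, Real.sq_sqrt hβ0, Real.sq_sqrt N.cast_nonneg]
    refine Real.exp_le_exp.2 ?_
    rcases eq_or_ne N 0 with rfl | hN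
    · simp; positivity
    · have : (N : ℝ) ≠ 0 := by exact_mod_cast hN
      field_simp
      rfl

lemma exists_integral_cexp_sq_gaussianReal {β : ℝ} (hβ0 : 0 ≤ β) (hβ1 : β < 1) :
    ∃ C : ℂ, C ≠ 0 ∧ ∀ s : ℂ,
      ∫ x : ℝ, Complex.exp ((√β * x + s) ^ 2 / 2) ∂(gaussianReal 0 1) =
        C * Complex.exp (s ^ 2 / (2 * (1 - β))) := by
  have hβ : (1 - β : ℂ) ≠ 0 := by exact_mod_cast (sub_pos.2 hβ1).ne'
  have hsq : (√β : ℂ) ^ 2 = β := by rw [← Complex.ofReal_pow, Real.sq_sqrt hβ0]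
  have hb : (-((1 - β) / 2 : ℂ)).re < 0 := by
    have : ((1 - β) / 2 : ℂ) = ((1 - β) / 2 : ℝ) := by push_cast; rfl
    rw [this, Complex.neg_re, Complex.ofReal_re]
    linarith
  refine ⟨(√(2 * π) : ℂ)⁻¹ * (π / -(-((1 - β) / 2 : ℂ))) ^ (1 / 2 : ℂ), ?_, fun s ↦ ?_⟩
  · have hpi : (√(2 * π) : ℂ) ≠ 0 := by
      exact_mod_cast (Real.sqrt_pos.2 (by positivity : 0 < 2 * π)).ne'
    refine mul_ne_zero (inv_ne_zero hpi) ?_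
    rw [Complex.cpow_ne_zero_iff]
    left
    rw [neg_neg]
    refine div_ne_zero (by exact_mod_cast Real.pi_ne_zero) (div_ne_zero hβ two_ne_zero)
  · have h := integral_cexp_quadratic hb (√β * s) (s ^ 2 / 2)
    rw [integral_gaussianReal_eq_integral_smul one_ne_zero]
    have hint : ∀ x : ℝ, gaussianPDFReal 0 1 x • Complex.exp ((√β * x + s) ^ 2 / 2) =
        (√(2 * π) : ℂ)⁻¹ *
          Complex.exp (-((1 - β) / 2 : ℂ) * x ^ 2 + √β * s * x + s ^ 2 / 2) := by
      intro x
      rw [gaussianPDFReal_def, Complex.real_smul]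
      push_cast
      rw [mul_one, mul_assoc, ← Complex.exp_add]
      congr 2
      linear_combination (x : ℂ) ^ 2 / 2 * hsq
    simp_rw [hint]
    rw [integral_const_mul, h, mul_assoc]
    congr 3
    rw [mul_pow, hsq]
    field_simp
    ring

/-- Central limit theorem for the Curie–Weiss model: for `0 ≤ β < 1` the laws of
`S_N / √N` converge weakly to the normal distribution `N(0, 1/(1-β))`. -/
theorem cw_clt (β : ℝ) (hβ0 : 0 ≤ β) (hβ1 : β < 1) :
    ∀ f : BoundedContinuousFunction ℝ ℝ,
      Tendsto (fun N : ℕ =>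
          ∫ x, f x ∂(cwLaw β N (fun σ => (∑ i, spin (σ i)) / Real.sqrt N)))
        atTop (𝓝 (∫ x, f x ∂(gaussianReal 0 (Real.toNNReal (1 / (1 - β)))))) := by
  let μ : ℕ → ProbabilityMeasure ℝ := fun N ↦
    ⟨cwLaw β N (fun σ => (∑ i, spin (σ i)) / √N), inferInstance⟩
  let ν : ProbabilityMeasure ℝ := ⟨gaussianReal 0 (Real.toNNReal (1 / (1 - β))), inferInstance⟩
  suffices h : Tendsto μ atTop (𝓝 ν) from
    ProbabilityMeasure.tendsto_iff_forall_integral_tendsto.1 h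
  refine ProbabilityMeasure.tendsto_of_tendsto_charFun fun t ↦ ?_
  obtain ⟨C, hC, hint⟩ := exists_integral_cexp_sq_gaussianReal hβ0 hβ1
  have hnum := tendsto_cwMGF_div_two_pow hβ0 hβ1 (s := t * Complex.I) (by simp)
  have hden := tendsto_cwMGF_div_two_pow hβ0 hβ1 (s := 0) (by simp)
  rw [hint] at hnum hden
  have hlim := hnum.div hden (by simpa using hC)
  have hν : charFun (ν : Measure ℝ) t = C * Complex.exp ((t * Complex.I) ^ 2 / (2 * (1 - β))) /
      (C * Complex.exp (0 ^ 2 / (2 * (1 - β)))) := by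
    rw [mul_div_mul_left _ _ hC]
    simp only [ν, ProbabilityMeasure.coe_mk]
    rw [charFun_gaussianReal, Real.coe_toNNReal _ (by rw [one_div, inv_nonneg]; linarith)]
    simp only [mul_pow, Complex.I_sq]
    have hβ : (1 - β : ℂ) ≠ 0 := by exact_mod_cast (sub_pos.2 hβ1).ne'
    push_cast
    rw [zero_pow two_ne_zero, zero_div, Complex.exp_zero, div_one]
    congr 1
    field_simp
    ring
  rw [hν]
  refine hlim.congr fun N ↦ ?_
  simp only [μ, ProbabilityMeasure.coe_mk, Pi.div_apply]
  rw [charFun_cwLaw, div_div_div_cancel_right₀ (by simp)]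
end

section
/- Asymptotics of critical Curie–Weiss correlations: fix an even ℓ ≥ 2. For each N ≥ ℓ let X_1,…,X_N be CW(1,N)-distributed. Then N^{ℓ/4} · E_{1,N}(X_1·X_2·…·X_ℓ) → (∫_{−∞}^{∞} t^ℓ e^{−t⁴/12} dt)/(∫_{−∞}^{∞} e^{−t⁴/12} dt) as N → ∞. -/
open MeasureTheory Filter Real Topology ENNReal

open Asymptotics

/-- Completing the square in the exponent of a Gaussian with a linear term. -/
theorem exp_quadratic_add_linear_eq (b s y : ℝ) (hb : 0 < b) :
    exp (-(b * y ^ 2 / 2) + s * y) =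
      exp (s ^ 2 / (2 * b)) * exp (-(b / 2) * (y - s / b) ^ 2) := by
  rw [← exp_add]
  congr 1
  field_simp
  ring

theorem integrable_exp_quadratic_add_linear (b s : ℝ) (hb : 0 < b) :
    Integrable fun y : ℝ => exp (-(b * y ^ 2 / 2) + s * y) := by
  simp_rw [exp_quadratic_add_linear_eq b s _ hb]
  exact ((integrable_exp_neg_mul_sq (half_pos hb)).comp_sub_right (s / b)).const_mul _

/-- The Gaussian integral with a linear term (Hubbard–Stratonovich transform). -/
theorem integral_exp_quadratic_add_linear (b s : ℝ) (hb : 0 < b) :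
    ∫ y : ℝ, exp (-(b * y ^ 2 / 2) + s * y) = exp (s ^ 2 / (2 * b)) * √(π / (b / 2)) := by
  simp_rw [exp_quadratic_add_linear_eq b s _ hb]
  rw [integral_const_mul,
    integral_sub_right_eq_self (fun y : ℝ => exp (-(b / 2) * y ^ 2)) (s / b), integral_gaussian]

theorem sum_exp_mul_prod_spin (N ℓ : ℕ) (hN : ℓ ≤ N) (y : ℝ) :
    ∑ σ : Fin N → Bool, exp ((∑ i, spin (σ i)) * y) *
        ∏ j ∈ Finset.univ.filter (fun j : Fin N => (j : ℕ) < ℓ), spin (σ j) =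
      2 ^ N * (cosh y ^ N * tanh y ^ ℓ) := by
  have h1 : ∀ σ : Fin N → Bool, exp ((∑ i, spin (σ i)) * y) *
        ∏ j ∈ Finset.univ.filter (fun j : Fin N => (j : ℕ) < ℓ), spin (σ j) =
      ∏ i, (exp (spin (σ i) * y) * if (i : ℕ) < ℓ then spin (σ i) else 1) := by
    intro σ
    rw [Finset.prod_mul_distrib, Finset.sum_mul, exp_sum, Finset.prod_filter]
  have h2 : ∀ i : Fin N, ∑ b : Bool, (exp (spin b * y) * if (i : ℕ) < ℓ then spin b else 1) =
      2 * cosh y * if (i : ℕ) < ℓ then tanh y else 1 := by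
    intro i
    have hc := (cosh_pos y).ne'
    rw [tanh_eq_sinh_div_cosh]
    split_ifs
    · rw [mul_assoc, mul_div_cancel₀ _ hc, sinh_eq]
      simp [spin]
      ring
    · rw [cosh_eq]
      simp [spin]
      ring
  have hcard : (Finset.univ.filter (fun j : Fin N => (j : ℕ) < ℓ)).card = ℓ := by
    rw [Fin.card_filter_val_lt, min_eq_right hN]
  simp_rw [h1]
  rw [← Fintype.prod_sum (fun (i : Fin N) (b : Bool) =>
    exp (spin b * y) * if (i : ℕ) < ℓ then spin b else 1)]
  simp_rw [h2]
  rw [Finset.prod_mul_distrib, ← Finset.prod_filter, Finset.prod_const, Finset.prod_const, hcard,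
    Finset.card_univ, Fintype.card_fin, mul_pow, mul_assoc]

/-- The integral representation of unnormalized critical correlations. -/
theorem sum_cwWeight_mul_prod_spin (N ℓ : ℕ) (hN0 : 0 < N) (hN : ℓ ≤ N) :
    √(π / (N / 2)) * ∑ σ : Fin N → Bool, cwWeight 1 N σ *
        ∏ j ∈ Finset.univ.filter (fun j : Fin N => (j : ℕ) < ℓ), spin (σ j) =
      2 ^ N * ∫ y : ℝ, (cosh y * exp (-(y ^ 2 / 2))) ^ N * tanh y ^ ℓ := by
  have hb : (0 : ℝ) < N := by exact_mod_cast hN0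
  have h1 : ∀ σ : Fin N → Bool, √(π / (N / 2)) * cwWeight 1 N σ =
      ∫ y : ℝ, exp (-(N * y ^ 2 / 2) + (∑ i, spin (σ i)) * y) := by
    intro σ
    rw [integral_exp_quadratic_add_linear _ _ hb, cwWeight, mul_comm]
    congr 2
    ring
  rw [Finset.mul_sum]
  simp_rw [← mul_assoc, h1, ← integral_mul_const]
  rw [← integral_finsetSum _
    fun σ _ => (integrable_exp_quadratic_add_linear _ _ hb).mul_const _, ← integral_const_mul]
  congr 1
  ext y
  simp_rw [exp_add, mul_assoc]
  rw [← Finset.mul_sum, sum_exp_mul_prod_spin N ℓ hN, mul_pow, ← exp_nat_mul,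
    show (N : ℝ) * -(y ^ 2 / 2) = -(N * (y ^ 2 / 2)) by ring,
    show (N : ℝ) * y ^ 2 / 2 = N * (y ^ 2 / 2) by ring]
  ring

/-- Critical correlations as a quotient of rescaled integrals. -/
theorem inv_pow_mul_cwCorr_eq (N ℓ : ℕ) (hN0 : 0 < N) (hN : ℓ ≤ N) {a : ℝ} (ha : 0 < a) :
    a⁻¹ ^ ℓ * cwCorr 1 N ℓ =
      (∫ t : ℝ, (cosh (a * t) * exp (-((a * t) ^ 2 / 2))) ^ N * (a⁻¹ * tanh (a * t)) ^ ℓ) /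
        ∫ t : ℝ, (cosh (a * t) * exp (-((a * t) ^ 2 / 2))) ^ N * (a⁻¹ * tanh (a * t)) ^ 0 := by
  have hb : (0 : ℝ) < N := by exact_mod_cast hN0
  have hs : √(π / ((N : ℝ) / 2)) ≠ 0 := (sqrt_pos.2 (div_pos pi_pos (half_pos hb))).ne'
  have hscale : ∀ k : ℕ, ∫ t : ℝ,
      (cosh (a * t) * exp (-((a * t) ^ 2 / 2))) ^ N * (a⁻¹ * tanh (a * t)) ^ k =
      a⁻¹ ^ k * (a⁻¹ * ∫ y : ℝ, (cosh y * exp (-(y ^ 2 / 2))) ^ N * tanh y ^ k) := by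
    intro k
    have h := Measure.integral_comp_mul_left
      (fun y : ℝ => (cosh y * exp (-(y ^ 2 / 2))) ^ N * tanh y ^ k) a
    rw [abs_of_pos (inv_pos.2 ha), smul_eq_mul] at h
    rw [← h, ← integral_const_mul]
    congr 1
    ext t
    rw [mul_pow]
    ring
  have hnum := sum_cwWeight_mul_prod_spin N ℓ hN0 hN
  have hden := sum_cwWeight_mul_prod_spin N 0 hN0 (Nat.zero_le _)
  simp only [Nat.not_lt_zero, Finset.filter_false, Finset.prod_empty, mul_one] at hden
  rw [hscale, hscale, cwCorr, cwExp, cwZ, pow_zero, one_mul, mul_div_assoc,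
    mul_div_mul_left _ _ (inv_pos.2 ha).ne',
    ← mul_div_mul_left (∫ y : ℝ, _) _ (pow_ne_zero N (two_ne_zero' ℝ)), ← hnum, ← hden,
    mul_div_mul_left _ _ hs]

theorem cosh_mul_exp_neg_le (y : ℝ) :
    cosh y * exp (-(y ^ 2 / 2)) ≤ 1 - (1 - exp (-(y ^ 2 / 4))) ^ 2 := by
  have h1 : cosh y ≤ 2 * exp (y ^ 2 / 4) - 1 := by
    have h := cosh_le_exp_half_sq (y / 2)
    have h2 : cosh y = 2 * cosh (y / 2) ^ 2 - 1 := by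
      have h3 := cosh_two_mul (y / 2)
      rw [mul_div_cancel₀ _ two_ne_zero, sinh_sq] at h3
      linarith
    have h4 : cosh (y / 2) ^ 2 ≤ exp (y ^ 2 / 4) := by
      calc cosh (y / 2) ^ 2 ≤ exp ((y / 2) ^ 2 / 2) ^ 2 :=
            pow_le_pow_left₀ (cosh_pos _).le h 2
        _ = exp (y ^ 2 / 4) := by rw [← exp_nat_mul]; congr 1; push_cast; ring
    linarith
  have h2 : exp (-(y ^ 2 / 2)) = exp (-(y ^ 2 / 4)) ^ 2 := by
    rw [← exp_nat_mul]; congr 1; push_cast; ring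
  have h3 : exp (y ^ 2 / 4) * exp (-(y ^ 2 / 4)) = 1 := by rw [← exp_add]; simp
  calc cosh y * exp (-(y ^ 2 / 2))
      ≤ (2 * exp (y ^ 2 / 4) - 1) * exp (-(y ^ 2 / 2)) :=
        mul_le_mul_of_nonneg_right h1 (exp_pos _).le
    _ = 1 - (1 - exp (-(y ^ 2 / 4))) ^ 2 := by
        rw [h2]; linear_combination 2 * exp (-(y ^ 2 / 4)) * h3

theorem cosh_mul_exp_neg_le_of_sq_le {y : ℝ} (hy : y ^ 2 ≤ 8) :
    cosh y * exp (-(y ^ 2 / 2)) ≤ exp (-(y ^ 4 / 144)) := by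
  have h1 : exp (-(y ^ 2 / 4)) ≤ 1 - y ^ 2 / 12 := by
    have h2 := add_one_le_exp (y ^ 2 / 4)
    have h3 : exp (-(y ^ 2 / 4)) * exp (y ^ 2 / 4) = 1 := by rw [← exp_add]; simp
    have h4 := exp_pos (-(y ^ 2 / 4))
    have h5 : exp (-(y ^ 2 / 4)) * (y ^ 2 / 4 + 1) ≤ 1 :=
      (mul_le_mul_of_nonneg_left h2 h4.le).trans h3.le
    have h6 : 1 ≤ (1 - y ^ 2 / 12) * (y ^ 2 / 4 + 1) := by nlinarith [sq_nonneg y]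
    exact le_of_mul_le_mul_right (h5.trans h6) (by positivity)
  have h2 : y ^ 4 / 144 ≤ (1 - exp (-(y ^ 2 / 4))) ^ 2 := by
    have h := pow_le_pow_left₀ (by positivity : (0 : ℝ) ≤ y ^ 2 / 12)
      (by linarith : y ^ 2 / 12 ≤ 1 - exp (-(y ^ 2 / 4))) 2
    linarith [h, show (y ^ 2 / 12) ^ 2 = y ^ 4 / 144 by ring]
  linarith [cosh_mul_exp_neg_le y, add_one_le_exp (-(y ^ 4 / 144))]

theorem cosh_mul_exp_neg_le_of_le_sq {y : ℝ} (hy : 8 ≤ y ^ 2) :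
    cosh y * exp (-(y ^ 2 / 2)) ≤ exp (-(y ^ 2 / 8)) := by
  have h1 : exp (-(y ^ 2 / 4)) = exp (-(y ^ 2 / 8)) ^ 2 := by
    rw [← exp_nat_mul]; congr 1; push_cast; ring
  have h2 : exp (-(y ^ 2 / 8)) ≤ 1 / 2 := by
    have h3 : exp (-(y ^ 2 / 8)) ≤ exp (-1) := exp_le_exp.2 (by linarith)
    linarith [exp_neg_one_lt_d9]
  have h4 := cosh_mul_exp_neg_le y
  rw [h1] at h4
  nlinarith [exp_pos (-(y ^ 2 / 8)), sq_nonneg (exp (-(y ^ 2 / 8)) ^ 2)]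

theorem cosh_mul_exp_neg_pow_le {N : ℕ} {a : ℝ} (ha1 : a ^ 2 ≤ 1) (haN : N * a ^ 4 = 1)
    (t : ℝ) :
    (cosh (a * t) * exp (-((a * t) ^ 2 / 2))) ^ N ≤ exp (1 / 9) * exp (-(1 / 18) * t ^ 2) := by
  have h0 : 0 ≤ cosh (a * t) * exp (-((a * t) ^ 2 / 2)) :=
    mul_nonneg (cosh_pos _).le (exp_pos _).le
  rw [← exp_add]
  rcases le_total ((a * t) ^ 2) 8 with h | h
  · refine (pow_le_pow_left₀ h0 (cosh_mul_exp_neg_le_of_sq_le h) N).trans ?_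
    rw [← exp_nat_mul, exp_le_exp,
      show (N : ℝ) * -((a * t) ^ 4 / 144) = -((N * a ^ 4) * t ^ 4 / 144) by ring, haN]
    linarith [sq_nonneg (t ^ 2 / 12 - 1 / 3),
      show (t ^ 2 / 12 - 1 / 3) ^ 2 = t ^ 4 / 144 - t ^ 2 / 18 + 1 / 9 by ring]
  · refine (pow_le_pow_left₀ h0 (cosh_mul_exp_neg_le_of_le_sq h) N).trans ?_
    rw [← exp_nat_mul, exp_le_exp,
      show (N : ℝ) * -((a * t) ^ 2 / 8) = -((N * a ^ 2) * t ^ 2 / 8) by ring]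
    have h2 : 1 ≤ N * a ^ 2 := by
      have h3 : (N * a ^ 2) * a ^ 2 ≤ N * a ^ 2 := mul_le_of_le_one_right (by positivity) ha1
      linarith [h3, show (N * a ^ 2) * a ^ 2 = N * a ^ 4 by ring]
    have h4 : t ^ 2 ≤ N * a ^ 2 * t ^ 2 := le_mul_of_one_le_left (sq_nonneg t) h2
    linarith [sq_nonneg t]

theorem abs_tanh_le (y : ℝ) : |tanh y| ≤ |y| := by
  have key : ∀ x : ℝ, 0 ≤ x → sinh x ≤ x * cosh x := by
    intro x hx
    have hmono : MonotoneOn (fun x : ℝ => x * cosh x - sinh x) (Set.Ici 0) := by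
      refine monotoneOn_of_deriv_nonneg (convex_Ici 0) (by fun_prop) (by fun_prop) ?_
      intro z hz
      rw [interior_Ici] at hz
      have hd : HasDerivAt (fun x : ℝ => x * cosh x - sinh x)
          (1 * cosh z + z * sinh z - cosh z) z :=
        ((hasDerivAt_id z).mul (hasDerivAt_cosh z)).sub (hasDerivAt_sinh z)
      rw [hd.deriv]
      have := mul_nonneg (le_of_lt hz) (sinh_nonneg_iff.2 (le_of_lt hz))
      linarith
    have := hmono (Set.mem_Ici.2 le_rfl) hx hx
    simp at this
    exact this
  rw [tanh_eq_sinh_div_cosh, abs_div, abs_of_pos (cosh_pos y), div_le_iff₀ (cosh_pos y), abs_sinh]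
  simpa using key |y| (abs_nonneg y)

theorem cosh_mul_exp_neg_isLittleO :
    (fun y : ℝ => cosh y * exp (-(y ^ 2 / 2)) - 1 + y ^ 4 / 12) =o[𝓝 0] fun y => y ^ 4 := by
  have hexp := exp_sub_sum_range_succ_isLittleO_pow 4
  have hneg : Tendsto (fun y : ℝ => -y) (𝓝 0) (𝓝 0) := by
    simpa using (continuous_neg (G := ℝ)).tendsto 0
  have hexpneg : (fun y : ℝ => exp (-y) - ∑ i ∈ Finset.range (4 + 1), (-y) ^ i / i.factorial)
      =o[𝓝 0] fun y => y ^ 4 := by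
    simpa [Function.comp_def, Even.neg_pow (show Even 4 by decide)] using
      hexp.comp_tendsto hneg
  have hsq : Tendsto (fun y : ℝ => y ^ 2 / 2) (𝓝 0) (𝓝 0) := by
    have : Continuous fun y : ℝ => y ^ 2 / 2 := by fun_prop
    simpa using this.tendsto 0
  have hexpsq : (fun y : ℝ => exp (y ^ 2 / 2) -
      ∑ i ∈ Finset.range (2 + 1), (y ^ 2 / 2) ^ i / i.factorial) =o[𝓝 0] fun y => y ^ 4 := by
    have h := (exp_sub_sum_range_succ_isLittleO_pow 2).comp_tendsto hsq
    refine h.trans_isBigO ?_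
    refine IsBigO.of_bound 1 (Eventually.of_forall fun y => ?_)
    simp only [Function.comp_apply, norm_eq_abs]
    rw [show (y ^ 2 / 2) ^ 2 = y ^ 4 / 4 by ring, abs_of_nonneg (by positivity),
      abs_of_nonneg (by positivity)]
    linarith [show 0 ≤ y ^ 4 by positivity]
  have hdiff : (fun y : ℝ => cosh y - exp (y ^ 2 / 2) + y ^ 4 / 12) =o[𝓝 0] fun y => y ^ 4 := by
    refine (((hexp.add hexpneg).const_mul_left (1 / 2)).sub hexpsq).congr_left fun y => ?_
    rw [cosh_eq]
    simp [Finset.sum_range_succ, Nat.factorial]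
    ring
  have hone : Tendsto (fun y : ℝ => exp (-(y ^ 2 / 2))) (𝓝 0) (𝓝 1) := by
    have : Continuous fun y : ℝ => exp (-(y ^ 2 / 2)) := by fun_prop
    simpa using this.tendsto 0
  have hmain : (fun y : ℝ => (cosh y - exp (y ^ 2 / 2) + y ^ 4 / 12) * exp (-(y ^ 2 / 2)))
      =o[𝓝 0] fun y => y ^ 4 := by
    simpa using hdiff.mul_isBigO (hone.isBigO_one ℝ)
  have hrest : (fun y : ℝ => y ^ 4 * (1 / 12 * (1 - exp (-(y ^ 2 / 2)))))
      =o[𝓝 0] fun y => y ^ 4 := by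
    have h : Tendsto (fun y : ℝ => 1 / 12 * (1 - exp (-(y ^ 2 / 2)))) (𝓝 0) (𝓝 0) := by
      have h := (hone.const_sub 1).const_mul (1 / 12)
      rwa [sub_self, mul_zero] at h
    simpa using (isBigO_refl (fun y : ℝ => y ^ 4) (𝓝 0)).mul_isLittleO ((isLittleO_one_iff ℝ).2 h)
  refine (hmain.add hrest).congr_left fun y => ?_
  have h : exp (y ^ 2 / 2) * exp (-(y ^ 2 / 2)) = 1 := by rw [← exp_add]; simp
  linear_combination -h

theorem tendsto_cosh_mul_exp_neg_pow {a : ℕ → ℝ} (ha0 : Tendsto a atTop (𝓝 0))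
    (haN : ∀ᶠ N : ℕ in atTop, N * a N ^ 4 = 1) (t : ℝ) :
    Tendsto (fun N : ℕ => (cosh (a N * t) * exp (-((a N * t) ^ 2 / 2))) ^ N) atTop
      (𝓝 (exp (-(t ^ 4) / 12))) := by
  have hat : Tendsto (fun N => a N * t) atTop (𝓝 0) := by simpa using ha0.mul_const t
  have h1 := (isBigO_refl (fun N : ℕ => (N : ℝ)) atTop).mul_isLittleO
    (cosh_mul_exp_neg_isLittleO.comp_tendsto hat)
  have h2 : (fun N : ℕ => (N : ℝ) * ((fun y : ℝ => y ^ 4) ∘ fun N => a N * t) N)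
      =ᶠ[atTop] fun _ => t ^ 4 := by
    filter_upwards [haN] with N hN
    simp only [Function.comp_apply]
    linear_combination t ^ 4 * hN
  have h3 := (h1.trans_eventuallyEq h2).trans_isBigO
    (isBigO_const_const (t ^ 4) (one_ne_zero' ℝ) atTop)
  rw [isLittleO_one_iff ℝ] at h3
  have h4 : Tendsto (fun N : ℕ => (N : ℝ) * (cosh (a N * t) * exp (-((a N * t) ^ 2 / 2)) - 1))
      atTop (𝓝 (-(t ^ 4) / 12)) := by
    have h5 := h3.sub_const (t ^ 4 / 12)
    rw [zero_sub, ← neg_div] at h5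
    refine h5.congr' ?_
    filter_upwards [haN] with N hN
    simp only [Function.comp_apply]
    linear_combination t ^ 4 / 12 * hN
  refine (tendsto_one_add_pow_exp_of_tendsto h4).congr fun N => ?_
  rw [add_sub_cancel]

theorem tendsto_inv_mul_tanh {a : ℕ → ℝ} (ha0 : Tendsto a atTop (𝓝 0))
    (haN : ∀ᶠ N : ℕ in atTop, N * a N ^ 4 = 1) (t : ℝ) :
    Tendsto (fun N : ℕ => (a N)⁻¹ * tanh (a N * t)) atTop (𝓝 t) := by
  have hd : HasDerivAt (fun x : ℝ => tanh (x * t)) t 0 := by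
    have h1 : HasDerivAt (fun x : ℝ => x * t) t 0 := by simpa using (hasDerivAt_id 0).mul_const t
    have h2 := (h1.sinh).div (h1.cosh) (by simp)
    simp at h2
    refine h2.congr_of_eventuallyEq (Eventually.of_forall fun x => ?_)
    simp [tanh_eq_sinh_div_cosh]
  rw [hasDerivAt_iff_tendsto_slope] at hd
  have hne : Tendsto a atTop (𝓝[≠] 0) := by
    refine tendsto_nhdsWithin_iff.2 ⟨ha0, ?_⟩
    filter_upwards [haN] with N hN h
    simp only [Set.mem_singleton_iff] at h
    simp [h] at hN
  refine (hd.comp hne).congr fun N => ?_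
  simp [slope_def_field, div_eq_inv_mul]

theorem tendsto_integral_cosh_mul_exp_neg_pow {a : ℕ → ℝ} (ha0 : Tendsto a atTop (𝓝 0))
    (haN : ∀ᶠ N : ℕ in atTop, N * a N ^ 4 = 1) (ℓ : ℕ) :
    Tendsto (fun N : ℕ => ∫ t : ℝ,
      (cosh (a N * t) * exp (-((a N * t) ^ 2 / 2))) ^ N * ((a N)⁻¹ * tanh (a N * t)) ^ ℓ) atTop
      (𝓝 (∫ t : ℝ, t ^ ℓ * exp (-(t ^ 4) / 12))) := by
  have hcont : Continuous tanh := by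
    have : tanh = fun x => sinh x / cosh x := funext tanh_eq_sinh_div_cosh
    rw [this]
    exact continuous_sinh.div continuous_cosh fun x => (cosh_pos x).ne'
  refine tendsto_integral_filter_of_dominated_convergence
    (fun t : ℝ => exp (1 / 9) * ‖t ^ (ℓ : ℝ) * exp (-(1 / 18) * t ^ 2)‖) ?_ ?_ ?_ ?_
  · refine Eventually.of_forall fun N => Continuous.aestronglyMeasurable ?_
    fun_prop
  · have ha1 : ∀ᶠ N in atTop, a N ^ 2 ≤ 1 := by
      have h : Tendsto (fun N => a N ^ 2) atTop (𝓝 0) := by simpa using ha0.pow 2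
      exact h.eventually_le_const one_pos
    filter_upwards [haN, ha1] with N hN h1
    refine Eventually.of_forall fun t => ?_
    have hne : a N ≠ 0 := fun h => by simp [h] at hN
    have hp := cosh_mul_exp_neg_pow_le h1 hN t
    have ht : |(a N)⁻¹ * tanh (a N * t)| ≤ |t| := by
      rw [abs_mul, abs_inv, inv_mul_le_iff₀ (abs_pos.2 hne), ← abs_mul]
      exact abs_tanh_le _
    have h0 : 0 ≤ cosh (a N * t) * exp (-((a N * t) ^ 2 / 2)) :=
      mul_nonneg (cosh_pos _).le (exp_pos _).le
    rw [norm_mul, norm_mul, Real.rpow_natCast, norm_pow, norm_pow, norm_pow, norm_eq_abs, norm_eq_abs,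
      norm_eq_abs, norm_eq_abs, abs_of_nonneg h0, abs_of_pos (exp_pos _)]
    calc _ ≤ exp (1 / 9) * exp (-(1 / 18) * t ^ 2) * |t| ^ ℓ :=
          mul_le_mul hp (pow_le_pow_left₀ (abs_nonneg _) ht ℓ) (by positivity) (by positivity)
      _ = _ := by ring
  · exact (integrable_rpow_mul_exp_neg_mul_sq (by norm_num)
      (lt_of_lt_of_le (by norm_num) (Nat.cast_nonneg ℓ))).norm.const_mul _
  · refine Eventually.of_forall fun t => ?_
    rw [mul_comm (t ^ ℓ)]
    exact (tendsto_cosh_mul_exp_neg_pow ha0 haN t).mul ((tendsto_inv_mul_tanh ha0 haN t).pow ℓ)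

/-- Asymptotics of critical Curie–Weiss correlations: for even `ℓ ≥ 2`,
`N^{ℓ/4} · E_{1,N}(X_1 ⋯ X_ℓ) → (∫ t^ℓ e^{−t⁴/12} dt)/(∫ e^{−t⁴/12} dt)`. -/
theorem cw_corr_critical (ℓ : ℕ) (hℓ : Even ℓ) (hℓ2 : 2 ≤ ℓ) :
    Tendsto (fun N : ℕ => (N : ℝ) ^ ((ℓ : ℝ) / 4) * cwCorr 1 N ℓ)
      atTop (𝓝 ((∫ t : ℝ, t ^ ℓ * Real.exp (-(t ^ 4) / 12)) /
        (∫ t : ℝ, Real.exp (-(t ^ 4) / 12)))) := by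
  have ha0 : Tendsto (fun N : ℕ => (N : ℝ) ^ (-(1 / 4) : ℝ)) atTop (𝓝 0) :=
    (tendsto_rpow_neg_atTop (by norm_num : (0 : ℝ) < 1 / 4)).comp tendsto_natCast_atTop_atTop
  have haN : ∀ᶠ N : ℕ in atTop, (N : ℝ) * ((N : ℝ) ^ (-(1 / 4) : ℝ)) ^ 4 = 1 := by
    filter_upwards [eventually_gt_atTop 0] with N hN
    have hN' : (0 : ℝ) < N := by exact_mod_cast hN
    rw [← Real.rpow_natCast, ← rpow_mul hN'.le]
    norm_num
    rw [Real.rpow_neg_one, mul_inv_cancel₀ hN'.ne']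
  have hden0 : (∫ t : ℝ, exp (-(t ^ 4) / 12)) ≠ 0 := by
    refine (integral_exp_pos ?_).ne'
    refine ((integrable_exp_neg_mul_sq (by norm_num : (0 : ℝ) < 1)).const_mul (exp 3)).mono'
      (Continuous.aestronglyMeasurable (by fun_prop)) (Eventually.of_forall fun t => ?_)
    rw [norm_eq_abs, abs_of_pos (exp_pos _), ← exp_add, exp_le_exp]
    linarith [sq_nonneg (t ^ 2 - 6), show (t ^ 2 - 6) ^ 2 = t ^ 4 - 12 * t ^ 2 + 36 by ring]
  have hnum := tendsto_integral_cosh_mul_exp_neg_pow ha0 haN ℓ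
  have hden := tendsto_integral_cosh_mul_exp_neg_pow ha0 haN 0
  rw [show (∫ t : ℝ, t ^ 0 * exp (-(t ^ 4) / 12)) = ∫ t : ℝ, exp (-(t ^ 4) / 12) by simp] at hden
  refine (hnum.div hden hden0).congr' ?_
  filter_upwards [eventually_gt_atTop 0, eventually_ge_atTop ℓ] with N hN0 hN
  have hN' : (0 : ℝ) < N := by exact_mod_cast hN0
  rw [Pi.div_apply, ← inv_pow_mul_cwCorr_eq N ℓ hN0 hN (rpow_pos_of_pos hN' _), rpow_neg hN'.le,
    inv_inv, ← Real.rpow_natCast, ← rpow_mul hN'.le]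
  congr 2
  ring
end

section
/- Moment convergence in the Curie–Weiss CLT: fix 0 < β < 1 and K ∈ ℕ. For each N let X_1,…,X_N be CW(β,N)-distributed and S_N = ∑_{i=1}^N X_i. Then, as N → ∞, E_{β,N}((S_N/√N)^K) converges to (K−1)!! · (1/(1−β))^{K/2} if K is even, and to 0 if K is odd; these limits are the moments of the normal distribution N(0, 1/(1−β)). -/
open MeasureTheory Filter Real Topology ENNReal

open ProbabilityTheory in
lemma integrable_pow_gaussianReal (m : ℝ) (v : NNReal) (n : ℕ) :
    Integrable (fun x : ℝ => x ^ n) (gaussianReal m v) := by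
  have h := (memLp_id_gaussianReal (μ := m) (v := v) n).integrable_norm_pow'
  refine h.mono' (by fun_prop) (ae_of_all _ fun x => ?_)
  simp

open ProbabilityTheory in
lemma integrable_gaussianPDFReal_mul_pow (m : ℝ) {v : NNReal} (hv : v ≠ 0) (n : ℕ) :
    Integrable (fun x : ℝ => gaussianPDFReal m v x * x ^ n) := by
  have h := integrable_pow_gaussianReal m v n
  rw [gaussianReal_of_var_ne_zero _ hv,
    integrable_withDensity_iff (measurable_gaussianPDF m v)
      (ae_of_all _ fun _ => gaussianPDF_lt_top)] at h
  simpa [mul_comm] using h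

open ProbabilityTheory in
lemma gaussianReal_moment_add_two {v : NNReal} (hv : v ≠ 0) (n : ℕ) :
    ∫ x, x ^ (n + 2) ∂(gaussianReal 0 v) = (n + 1) * v * ∫ x, x ^ n ∂(gaussianReal 0 v) := by
  have hv' : (v : ℝ) ≠ 0 := by exact_mod_cast hv
  have hpdf (x : ℝ) : HasDerivAt (gaussianPDFReal 0 v)
      (-(gaussianPDFReal 0 v x * x) / v) x := by
    have h := (((hasDerivAt_id x).pow 2).neg.div_const (2 * (v : ℝ))).exp.const_mul
      (√(2 * π * v))⁻¹
    have he : gaussianPDFReal 0 v =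
        fun x : ℝ => (√(2 * π * v))⁻¹ * rexp (-x ^ 2 / (2 * v)) := by
      ext y; simp [gaussianPDFReal]
    rw [he]
    refine h.congr_deriv ?_
    simp
    field_simp
  have hpow (x : ℝ) : HasDerivAt (fun x : ℝ => x ^ (n + 1)) ((n + 1) * x ^ n) x := by
    simpa using hasDerivAt_pow (n + 1) x
  have h := integral_mul_deriv_eq_deriv_mul_of_integrable
    (fun x _ => hpow x) (fun x _ => hpdf x)
    (((integrable_gaussianPDFReal_mul_pow 0 hv (n + 2)).const_mul (-(v : ℝ)⁻¹)).congr
      (ae_of_all _ fun x => by simp; field_simp; ring))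
    (((integrable_gaussianPDFReal_mul_pow 0 hv n).const_mul ((n : ℝ) + 1)).congr
      (ae_of_all _ fun x => by simp; ring))
    ((integrable_gaussianPDFReal_mul_pow 0 hv (n + 1)).congr
      (ae_of_all _ fun x => by simp; ring))
  simp only [integral_gaussianReal_eq_integral_smul hv, smul_eq_mul]
  have h1 : ∫ x, x ^ (n + 1) * (-(gaussianPDFReal 0 v x * x) / v) =
      -(v : ℝ)⁻¹ * ∫ x, gaussianPDFReal 0 v x * x ^ (n + 2) := by
    rw [← integral_const_mul]; congr 1; ext x; field_simp; ring
  have h2 : ∫ x, (n + 1) * x ^ n * gaussianPDFReal 0 v x =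
      (n + 1) * ∫ x, gaussianPDFReal 0 v x * x ^ n := by
    rw [← integral_const_mul]; congr 1; ext x; ring
  rw [h1, h2] at h
  field_simp at h
  linarith

open ProbabilityTheory in
/-- The moments of a centered Gaussian. -/
lemma gaussianReal_moment {v : NNReal} (hv : v ≠ 0) (n : ℕ) :
    ∫ x, x ^ n ∂(gaussianReal 0 v) =
      if Even n then (Nat.doubleFactorial (n - 1) : ℝ) * (v : ℝ) ^ (n / 2) else 0 := by
  induction n using Nat.twoStepInduction with
  | zero => simp
  | one => simp [integral_id_gaussianReal]
  | more n ih _ =>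
    rw [gaussianReal_moment_add_two hv, ih]
    rcases n with _ | n
    · simp
    · simp only [Nat.even_add_one, add_tsub_cancel_right]
      have h2 : (n + 1 + 2) / 2 = (n + 1) / 2 + 1 := by omega
      have h3 : n + 1 + 2 - 1 = n + 2 := rfl
      split_ifs <;> simp_all [Nat.doubleFactorial, pow_succ]
      ring

open ProbabilityTheory in
lemma integral_add_pow_gaussianReal (v : NNReal) (w : ℝ) (K : ℕ) :
    ∫ x, (w + x) ^ K ∂(gaussianReal 0 v) =
      ∑ j ∈ Finset.range (K + 1),
        w ^ j * ((∫ x, x ^ (K - j) ∂(gaussianReal 0 v)) * (K.choose j : ℝ)) := by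
  simp_rw [add_pow, mul_assoc]
  rw [integral_finsetSum _ fun j _ =>
    ((integrable_pow_gaussianReal 0 v _).mul_const _).const_mul _]
  simp_rw [integral_const_mul, integral_mul_const]

open ProbabilityTheory in
lemma gaussianReal_moment_add (u v : NNReal) (K : ℕ) :
    ∫ x, x ^ K ∂(gaussianReal 0 (u + v)) =
      ∑ j ∈ Finset.range (K + 1), (∫ x, x ^ j ∂(gaussianReal 0 u)) *
        ((∫ x, x ^ (K - j) ∂(gaussianReal 0 v)) * (K.choose j : ℝ)) := by
  have h := integrable_pow_gaussianReal 0 (u + v) K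
  have hc := gaussianReal_conv_gaussianReal (m₁ := 0) (m₂ := 0) (v₁ := u) (v₂ := v)
  rw [add_zero] at hc
  rw [← hc] at h ⊢
  rw [integral_conv h]
  simp_rw [integral_add_pow_gaussianReal]
  rw [integral_finsetSum _ fun j _ => (integrable_pow_gaussianReal 0 u _).mul_const _]
  simp_rw [integral_mul_const]

lemma sum_exp_mul_sum_spin (N : ℕ) (t : ℝ) :
    ∑ σ : Fin N → Bool, rexp (t * ∑ i, spin (σ i)) = 2 ^ N * Real.cosh t ^ N := by
  simp_rw [Finset.mul_sum, Real.exp_sum]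
  rw [← Fintype.prod_sum (fun (_ : Fin N) (b : Bool) => rexp (t * spin b))]
  simp [spin, Real.cosh_eq, ← mul_pow]
  congr 1
  ring

lemma tendsto_cosh_div_sqrt_pow (t : ℝ) :
    Tendsto (fun N : ℕ => Real.cosh (t / √N) ^ N) atTop (𝓝 (rexp (t ^ 2 / 2))) := by
  have hsqrt : Tendsto (fun N : ℕ => √(N : ℝ)) atTop atTop :=
    tendsto_sqrt_atTop.comp tendsto_natCast_atTop_atTop
  have hinv : Tendsto (fun N : ℕ => (√(N : ℝ))⁻¹) atTop (𝓝[≠] 0) :=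
    tendsto_nhdsWithin_iff.2 ⟨hsqrt.inv_tendsto_atTop, by
      filter_upwards [hsqrt.eventually_gt_atTop 0] with N hN using inv_ne_zero hN.ne'⟩
  have hderiv : HasDerivAt (fun s : ℝ => Real.sinh (s * (t / 2))) (t / 2) 0 := by
    simpa using ((hasDerivAt_id (0 : ℝ)).mul_const (t / 2)).sinh
  have hsinh : Tendsto (fun N : ℕ => √(N : ℝ) * Real.sinh (t / 2 / √N)) atTop (𝓝 (t / 2)) := by
    refine (hderiv.tendsto_slope_zero.comp hinv).congr fun N => ?_
    simp only [Function.comp_apply, inv_inv, zero_add, zero_mul, Real.sinh_zero, sub_zero,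
      smul_eq_mul]
    rw [inv_mul_eq_div]
  have hcosh (N : ℕ) : Real.cosh (t / √N) = 1 + 2 * Real.sinh (t / 2 / √N) ^ 2 := by
    rw [show t / √N = 2 * (t / 2 / √N) by ring, Real.cosh_two_mul, Real.cosh_sq]
    ring
  simp_rw [hcosh]
  refine Real.tendsto_one_add_pow_exp_of_tendsto ?_
  have h := (hsinh.pow 2).const_mul 2
  rw [show 2 * (t / 2) ^ 2 = t ^ 2 / 2 by ring] at h
  refine h.congr fun N => ?_
  rw [mul_pow, Real.sq_sqrt N.cast_nonneg]
  ring

lemma cosh_div_sqrt_pow_le (t : ℝ) (N : ℕ) : Real.cosh (t / √N) ^ N ≤ rexp (t ^ 2 / 2) := by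
  rcases N.eq_zero_or_pos with rfl | hN
  · simp only [pow_zero]
    exact Real.one_le_exp (by positivity)
  · calc Real.cosh (t / √N) ^ N ≤ rexp ((t / √N) ^ 2 / 2) ^ N := by
          gcongr
          exact Real.cosh_le_exp_half_sq _
      _ = rexp (t ^ 2 / 2) := by
          rw [← Real.exp_nat_mul, div_pow, Real.sq_sqrt N.cast_nonneg]
          congr 1
          field_simp

open ProbabilityTheory in
lemma gaussianPDFReal_zero_mul_exp {v : NNReal} (hv : v ≠ 0) (w x : ℝ) :
    gaussianPDFReal 0 v x * rexp (x / v * w) =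
      rexp (w ^ 2 / (2 * v)) * gaussianPDFReal w v x := by
  have hv' : (v : ℝ) ≠ 0 := by exact_mod_cast hv
  have h : rexp (-x ^ 2 / (2 * v)) * rexp (x / v * w) =
      rexp (w ^ 2 / (2 * v)) * rexp (-(x - w) ^ 2 / (2 * v)) := by
    rw [← Real.exp_add, ← Real.exp_add]
    congr 1
    field_simp
    ring
  simp only [gaussianPDFReal, sub_zero]
  linear_combination (√(2 * π * v))⁻¹ * h

open ProbabilityTheory in
lemma integrable_gaussianPDFReal_mul_pow_mul_exp {v : NNReal} (hv : v ≠ 0) (K : ℕ) (w : ℝ) :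
    Integrable (fun x : ℝ => gaussianPDFReal 0 v x * x ^ K * rexp (x / v * w)) := by
  refine ((integrable_gaussianPDFReal_mul_pow w hv K).const_mul (rexp (w ^ 2 / (2 * v)))).congr
    (ae_of_all _ fun x => ?_)
  linear_combination -x ^ K * gaussianPDFReal_zero_mul_exp hv w x

open ProbabilityTheory in
/-- Hubbard–Stratonovich transformation. -/
lemma exp_mul_integral_add_pow_gaussianReal {v : NNReal} (hv : v ≠ 0) (w : ℝ) (K : ℕ) :
    rexp (w ^ 2 / (2 * v)) * ∫ x, (w + x) ^ K ∂(gaussianReal 0 v) =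
      ∫ x, gaussianPDFReal 0 v x * x ^ K * rexp (x / v * w) := by
  have hmap := gaussianReal_map_const_add (μ := 0) (v := v) w
  rw [zero_add] at hmap
  have h : ∫ x, (w + x) ^ K ∂(gaussianReal 0 v) = ∫ x, x ^ K ∂(gaussianReal w v) := by
    rw [← hmap, integral_map (by fun_prop) (by fun_prop)]
  rw [h, integral_gaussianReal_eq_integral_smul hv, ← integral_const_mul]
  congr 1
  ext x
  rw [smul_eq_mul]
  linear_combination -x ^ K * gaussianPDFReal_zero_mul_exp hv w x

open ProbabilityTheory in
/-- The unnormalized `K`-th moment of `S_N/√N + G` at `β = 1/v`, where `G` is an independent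
centered Gaussian of variance `v`. -/
lemma sum_cwWeight_mul_integral {v : NNReal} (hv : v ≠ 0) (N K : ℕ) :
    ∑ σ : Fin N → Bool, cwWeight (v : ℝ)⁻¹ N σ *
        ∫ x, ((∑ i, spin (σ i)) / √N + x) ^ K ∂(gaussianReal 0 v) =
      2 ^ N * ∫ x, gaussianPDFReal 0 v x * x ^ K * Real.cosh (x / v / √N) ^ N := by
  have hw (σ : Fin N → Bool) : cwWeight (v : ℝ)⁻¹ N σ =
      rexp (((∑ i, spin (σ i)) / √N) ^ 2 / (2 * v)) := by
    rw [cwWeight, div_pow, Real.sq_sqrt N.cast_nonneg]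
    congr 1
    simp only [div_eq_mul_inv, mul_inv]
    ring
  simp_rw [hw, exp_mul_integral_add_pow_gaussianReal hv]
  rw [← integral_finsetSum _ fun σ _ => integrable_gaussianPDFReal_mul_pow_mul_exp hv K _,
    ← integral_const_mul]
  congr 1
  ext x
  rw [← Finset.mul_sum]
  simp_rw [show ∀ s : ℝ, x / v * (s / √N) = x / v / √N * s from fun s => by ring]
  rw [sum_exp_mul_sum_spin]
  ring

open ProbabilityTheory in
lemma gaussianPDFReal_mul_exp_sq {u v : NNReal} (hu : u ≠ 0) (hv : v ≠ 0)
    (huv : (u : ℝ)⁻¹ + (v : ℝ)⁻¹ = 1) (x : ℝ) :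
    gaussianPDFReal 0 v x * rexp ((x / v) ^ 2 / 2) =
      √(2 * π * (u + v : NNReal)) / √(2 * π * v) * gaussianPDFReal 0 (u + v) x := by
  have hu' : (0 : ℝ) < u := by positivity
  have hv' : (0 : ℝ) < v := by positivity
  have huv' : (u : ℝ) + v = u * v := by
    field_simp at huv
    linarith
  have hexp : rexp (-x ^ 2 / (2 * v)) * rexp ((x / v) ^ 2 / 2) =
      rexp (-x ^ 2 / (2 * (u + v : NNReal))) := by
    rw [← Real.exp_add, NNReal.coe_add, huv']
    congr 1
    field_simp
    linear_combination x ^ 2 * huv'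
  have hne : √(2 * π * (u + v : NNReal)) ≠ 0 := by positivity
  simp only [gaussianPDFReal, sub_zero]
  rw [mul_assoc, hexp]
  field_simp

open ProbabilityTheory in
lemma tendsto_integral_cosh_pow {u v : NNReal} (hu : u ≠ 0) (hv : v ≠ 0)
    (huv : (u : ℝ)⁻¹ + (v : ℝ)⁻¹ = 1) (K : ℕ) :
    Tendsto (fun N : ℕ => ∫ x, gaussianPDFReal 0 v x * x ^ K * Real.cosh (x / v / √N) ^ N)
      atTop (𝓝 (√(2 * π * (u + v : NNReal)) / √(2 * π * v) *
        ∫ x, x ^ K ∂(gaussianReal 0 (u + v)))) := by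
  have hne : u + v ≠ 0 := by positivity
  have hlim (x : ℝ) : gaussianPDFReal 0 v x * x ^ K * rexp ((x / v) ^ 2 / 2) =
      √(2 * π * (u + v : NNReal)) / √(2 * π * v) * (gaussianPDFReal 0 (u + v) x * x ^ K) := by
    linear_combination x ^ K * gaussianPDFReal_mul_exp_sq hu hv huv x
  simp_rw [integral_gaussianReal_eq_integral_smul hne, smul_eq_mul, ← integral_const_mul, ← hlim]
  refine tendsto_integral_of_dominated_convergence
    (fun x => ‖gaussianPDFReal 0 v x * x ^ K * rexp ((x / v) ^ 2 / 2)‖) (fun N => ?_) ?_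
    (fun N => ae_of_all _ fun x => ?_) (ae_of_all _ fun x => ?_)
  · have := measurable_gaussianPDFReal 0 v
    have h2 : Measurable fun x : ℝ => Real.cosh (x / v / √N) ^ N := by fun_prop
    exact ((this.mul (by fun_prop)).mul h2).aestronglyMeasurable
  · simp_rw [hlim]
    exact ((integrable_gaussianPDFReal_mul_pow 0 hne K).const_mul _).norm
  · rw [norm_mul, norm_mul (_ * _) (rexp _)]
    refine mul_le_mul_of_nonneg_left ?_ (norm_nonneg _)
    rw [Real.norm_of_nonneg (by have := Real.cosh_pos (x / v / √N); positivity),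
      Real.norm_of_nonneg (Real.exp_pos _).le]
    exact cosh_div_sqrt_pow_le _ N
  · exact (tendsto_cosh_div_sqrt_pow (x / v)).const_mul _

open ProbabilityTheory in
lemma tendsto_cwExp_integral {u v : NNReal} (hu : u ≠ 0) (hv : v ≠ 0)
    (huv : (u : ℝ)⁻¹ + (v : ℝ)⁻¹ = 1) (K : ℕ) :
    Tendsto (fun N : ℕ => cwExp (v : ℝ)⁻¹ N fun σ =>
        ∫ x, ((∑ i, spin (σ i)) / √N + x) ^ K ∂(gaussianReal 0 v))
      atTop (𝓝 (∫ x, x ^ K ∂(gaussianReal 0 (u + v)))) := by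
  have hc : √(2 * π * (u + v : NNReal)) / √(2 * π * v) ≠ 0 := by
    have : (0 : ℝ) < v := by positivity
    positivity
  have hZ (N : ℕ) : cwZ (v : ℝ)⁻¹ N =
      2 ^ N * ∫ x, gaussianPDFReal 0 v x * x ^ 0 * Real.cosh (x / v / √N) ^ N := by
    rw [← sum_cwWeight_mul_integral hv]
    simp [cwZ]
  have h := (tendsto_integral_cosh_pow hu hv huv K).div (tendsto_integral_cosh_pow hu hv huv 0)
    (by simpa using hc)
  simp only [pow_zero, integral_const, probReal_univ, one_smul, mul_one] at h
  rw [mul_div_cancel_left₀ _ hc] at h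
  refine h.congr fun N => ?_
  simp only [cwExp, sum_cwWeight_mul_integral hv, hZ, pow_zero, mul_one]
  exact (mul_div_mul_left _ _ (by positivity)).symm

lemma cwExp_sum {ι : Type*} (β : ℝ) (N : ℕ) (s : Finset ι) (f : ι → (Fin N → Bool) → ℝ)
    (c : ι → ℝ) :
    cwExp β N (fun σ => ∑ j ∈ s, f j σ * c j) = ∑ j ∈ s, cwExp β N (f j) * c j := by
  simp only [cwExp, Finset.mul_sum, div_mul_eq_mul_div, ← Finset.sum_div, Finset.sum_mul]
  rw [Finset.sum_comm]
  simp only [mul_assoc]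

open ProbabilityTheory in
lemma tendsto_cwExp_pow {u v : NNReal} (hu : u ≠ 0) (hv : v ≠ 0)
    (huv : (u : ℝ)⁻¹ + (v : ℝ)⁻¹ = 1) (K : ℕ) :
    Tendsto (fun N : ℕ => cwExp (v : ℝ)⁻¹ N fun σ => ((∑ i, spin (σ i)) / √N) ^ K)
      atTop (𝓝 (∫ x, x ^ K ∂(gaussianReal 0 u))) := by
  induction K using Nat.strong_induction_on with
  | _ K ih =>
    have h := tendsto_cwExp_integral hu hv huv K
    simp_rw [integral_add_pow_gaussianReal, cwExp_sum, gaussianReal_moment_add,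
      Finset.sum_range_succ] at h
    have hlow := tendsto_finsetSum (Finset.range K) fun j hj =>
      (ih j (Finset.mem_range.1 hj)).mul_const
        ((∫ x, x ^ (K - j) ∂(gaussianReal 0 v)) * (K.choose j : ℝ))
    simpa using h.sub hlow

/-- Moment convergence in the Curie–Weiss CLT: for `0 < β < 1`,
`E_{β,N}((S_N/√N)^K)` converges to `(K−1)!!·(1/(1−β))^{K/2}` for even `K` and to `0`
for odd `K` — the moments of the normal distribution `N(0, 1/(1−β))`. -/
theorem cw_clt_moments (β : ℝ) (hβ0 : 0 < β) (hβ1 : β < 1) (K : ℕ) :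
    Tendsto (fun N : ℕ =>
        cwExp β N (fun σ => ((∑ i, spin (σ i)) / Real.sqrt N) ^ K))
      atTop (𝓝 (if Even K then
        (Nat.doubleFactorial (K - 1) : ℝ) * (1 / (1 - β)) ^ (K / 2) else 0)) := by
  have h1 : 0 < 1 - β := sub_pos.2 hβ1
  lift β to NNReal using hβ0.le
  have hu : ((1 - (β : ℝ)).toNNReal)⁻¹ ≠ 0 := by simpa using h1
  have hv : β⁻¹ ≠ 0 := by
    have : β ≠ 0 := by rintro rfl; simp at hβ0
    simpa using this
  have h := tendsto_cwExp_pow hu hv (by simp [h1.le]) K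
  rw [gaussianReal_moment hu] at h
  simpa [h1.le] using h
end
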